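/- Let z > 2 and p = 1/(z−1). Let T_z : [0,1] → [0,1] be the Manneville map T_z(x) = x + x^z (mod 1) and let x̃ be the unique point of (0,1) with x̃ + x̃^z = 1. For x ∈ [0,1] let ω(x) ∈ {0,1}^ℕ be the symbolic orbit (ω(x))_i = 1 if T_z^i(x) ∈ (x̃,1] and 0 if T_z^i(x) ∈ [0,x̃], and let N_n(x) be the number of indices 0 ≤ i < n with (ω(x))_i = 1. Assume there is a constant C₂ > 0 with ∫₀¹ N_n(x) dx ≤ C₂·n^p for all n ≥ 1 (Lebesgue measure). Let Z : {0,1}* → {0,1}* and t : {0,1}* → ℕ be functions such that for every binary string s of length n ≥ 2: 1 ≤ t(s) ≤ 2·(n − max{n₀(s), n₁(s)} + 1), where n₀(s) and n₁(s) are the numbers of 0's and 1's in s, and |Z(s)| ≤ 8·n·Ĥ₁(s) + C₁·t(s)·log₂ log₂ (max{n/t(s), 4}) for a constant C₁ > 0. Then there exist C₃ > 0 and n₀ ∈ ℕ such that ∫₀¹ |Z(ω(x)^n)| dx ≤ C₃·n^p·log₂ n for all n ≥ n₀. -/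

import Mathlib

open Filter MeasureTheory
open scoped ENNReal

/-- The string of the first `n` symbols of an infinite sequence. -/
def pref {A : Type*} (ω : ℕ → A) (n : ℕ) : List A := (List.range n).map ω

/-- The Manneville map `T_z(x) = x + x^z (mod 1)` on `[0,1]`. -/
noncomputable def mann (z : ℝ) (x : ℝ) : ℝ := Int.fract (x + x ^ z)

/-- The first empirical entropy of a binary string:
`Ĥ₁(s) = -(n₀/n) log₂(n₀/n) - (n₁/n) log₂(n₁/n)` where `n₀, n₁` count the `0`'s
and `1`'s of `s` (convention `0·log₂ 0 = 0`). -/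
noncomputable def H1 (s : List Bool) : ℝ :=
  -(((s.count false : ℕ) : ℝ) / (s.length : ℝ)) *
      Real.logb 2 (((s.count false : ℕ) : ℝ) / (s.length : ℝ))
  - (((s.count true : ℕ) : ℝ) / (s.length : ℝ)) *
      Real.logb 2 (((s.count true : ℕ) : ℝ) / (s.length : ℝ))

theorem length_pref {A : Type*} (ω : ℕ → A) (n : ℕ) : (pref ω n).length = n := by
  simp [pref]

theorem count_true_pref (ω : ℕ → Bool) (n : ℕ) :
    (pref ω n).count true = ((Finset.range n).filter fun i => ω i = true).card := by
  induction n with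
  | zero => simp [pref]
  | succ n ih =>
    have h : pref ω (n + 1) = pref ω n ++ [ω n] := by simp [pref, List.range_succ]
    rw [h, List.count_append, ih, Finset.range_add_one, Finset.filter_insert]
    by_cases hn : ω n = true <;> simp [hn]

theorem measurable_mann (z : ℝ) : Measurable (mann z) :=
  (measurable_id.add (measurable_id.pow_const z)).fract

/-- `-(a / n) log₂ (a / n)`, scaled by `n`, is at most `2 (n - a)`. -/
theorem entropy_term_le_sub {a n : ℝ} (ha : 0 ≤ a) (hn : 0 < n) (han : a ≤ n) :
    n * (-(a / n) * Real.logb 2 (a / n)) ≤ 2 * (n - a) := by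
  rcases ha.eq_or_lt with rfl | ha
  · simpa using hn.le
  have h2 : (1 : ℝ) / 2 ≤ Real.log 2 := by linarith [Real.log_two_gt_d9]
  have hlog := Real.one_sub_inv_le_log_of_pos (div_pos ha hn)
  have e : n * (-(a / n) * Real.logb 2 (a / n)) = a * -Real.log (a / n) / Real.log 2 := by
    unfold Real.logb
    field_simp
  have h1 : a * -Real.log (a / n) ≤ n - a := by
    calc a * -Real.log (a / n) ≤ a * ((a / n)⁻¹ - 1) := by gcongr; linarith
      _ = n - a := by field_simp
  rw [e, div_le_iff₀ (by linarith)]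
  nlinarith

theorem entropy_term_le_mul_logb {k n : ℝ} (hk : k = 0 ∨ 1 ≤ k) (hn : 0 < n) :
    n * (-(k / n) * Real.logb 2 (k / n)) ≤ k * Real.logb 2 n := by
  rcases hk with rfl | hk
  · simp
  have hk0 : 0 < k := by linarith
  have e : n * (-(k / n) * Real.logb 2 (k / n)) = k * (Real.logb 2 n - Real.logb 2 k) := by
    rw [Real.logb_div hk0.ne' hn.ne']
    field_simp
    ring
  rw [e]
  have := Real.logb_nonneg one_lt_two hk
  gcongr
  linarith

theorem length_mul_H1_le (s : List Bool) (hs : 2 ≤ s.length) :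
    (s.length : ℝ) * H1 s ≤ 3 * (s.count true : ℝ) * Real.logb 2 s.length := by
  have hsum : (s.count false : ℝ) + s.count true = s.length := by
    exact_mod_cast List.count_false_add_count_true s
  have hs' : (2 : ℝ) ≤ s.length := by exact_mod_cast hs
  have hL : 1 ≤ Real.logb 2 s.length := by
    rw [Real.le_logb_iff_rpow_le one_lt_two (by linarith)]
    simpa using hs'
  have hk : (s.count true : ℝ) = 0 ∨ (1 : ℝ) ≤ s.count true := by
    rcases Nat.eq_zero_or_pos (s.count true) with h | h
    · left; exact_mod_cast h
    · right; exact_mod_cast h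
  have hk0 : (0 : ℝ) ≤ s.count true := Nat.cast_nonneg _
  have h1 := entropy_term_le_sub (a := s.count false) (n := s.length) (Nat.cast_nonneg _)
    (by linarith) (by linarith)
  have h2 := entropy_term_le_mul_logb (n := s.length) hk (by linarith)
  have e : (s.length : ℝ) * H1 s =
      s.length * (-((s.count false : ℝ) / s.length) *
        Real.logb 2 ((s.count false : ℝ) / s.length)) +
      s.length * (-((s.count true : ℝ) / s.length) *
        Real.logb 2 ((s.count true : ℝ) / s.length)) := by
    unfold H1
    ring
  rw [e]
  nlinarith

theorem logb_logb_max_le {n t : ℝ} (hn : 4 ≤ n) (ht : 1 ≤ t) :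
    Real.logb 2 (Real.logb 2 (max (n / t) 4)) ≤ Real.logb 2 n := by
  have h4 : (0 : ℝ) < Real.logb 2 (max (n / t) 4) :=
    Real.logb_pos one_lt_two (lt_of_lt_of_le (by norm_num) (le_max_right _ _))
  have hmax : max (n / t) 4 ≤ n := max_le (div_le_self (by linarith) ht) hn
  have hle : Real.logb 2 (max (n / t) 4) ≤ n := by
    refine (Real.logb_le_logb_of_le one_lt_two (by positivity) hmax).trans ?_
    rw [Real.logb_le_iff_le_rpow one_lt_two (by linarith)]
    have := one_add_mul_self_le_rpow_one_add (s := 1) (by norm_num) (p := n) (by linarith)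
    norm_num at this
    linarith
  exact Real.logb_le_logb_of_le one_lt_two h4 hle

/-- LZ77 on the Manneville map, `z > 2`: under the stated abstract properties of the
compression algorithm `Z` (with parsing-word count `t`), and the bound
`∫₀¹ N_n dx ≤ C₂ n^p` on the mean number of passages through `(x̃,1]`, the mean compressed
length satisfies `∫₀¹ |Z(ω(x)ⁿ)| dx ≤ C₃ n^p log₂ n` eventually, where `p = 1/(z-1)`. -/
theorem stmt_19 (z : ℝ) (hz : 2 < z) (p : ℝ) (hp : p = 1 / (z - 1))
    (xt : ℝ) (hxt : xt ∈ Set.Ioo (0 : ℝ) 1) (hxt1 : xt + xt ^ z = 1)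
    (ω : ℝ → ℕ → Bool)
    (hω : ∀ (x : ℝ) (i : ℕ), ω x i = true ↔ xt < (mann z)^[i] x)
    (N : ℕ → ℝ → ℕ)
    (hN : ∀ (n : ℕ) (x : ℝ), N n x = ((Finset.range n).filter fun i => ω x i = true).card)
    (C₂ : ℝ) (hC₂ : 0 < C₂)
    (hNint : ∀ n : ℕ, 1 ≤ n → ∫ x in Set.Icc (0 : ℝ) 1, (N n x : ℝ) ≤ C₂ * (n : ℝ) ^ p)
    (Z : List Bool → List Bool) (t : List Bool → ℕ)
    (C₁ : ℝ) (hC₁ : 0 < C₁)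
    (ht : ∀ s : List Bool, 2 ≤ s.length →
      1 ≤ t s ∧ (t s : ℝ) ≤ 2 * ((s.length : ℝ) - ((max (s.count false) (s.count true) : ℕ) : ℝ) + 1))
    (hZ : ∀ s : List Bool, 2 ≤ s.length →
      ((Z s).length : ℝ) ≤ 8 * (s.length : ℝ) * H1 s
        + C₁ * (t s : ℝ) * Real.logb 2 (Real.logb 2 (max ((s.length : ℝ) / (t s : ℝ)) 4))) :
    ∃ C₃ : ℝ, 0 < C₃ ∧ ∃ n₀ : ℕ, ∀ n : ℕ, n₀ ≤ n →
      ∫ x in Set.Icc (0 : ℝ) 1, ((Z (pref (ω x) n)).length : ℝ)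
        ≤ C₃ * (n : ℝ) ^ p * Real.logb 2 (n : ℝ) := by
  have hmeas : ∀ n, Measurable fun x => (N n x : ℝ) := by
    intro n
    have e : (fun x => (N n x : ℝ)) =
        fun x => ∑ i ∈ Finset.range n, if xt < (mann z)^[i] x then (1 : ℝ) else 0 := by
      funext x
      rw [hN, Finset.card_filter]
      push_cast
      simp only [hω]
    rw [e]
    refine Finset.measurable_sum _ fun i _ => ?_
    exact Measurable.ite (measurableSet_lt measurable_const ((measurable_mann z).iterate i))
      measurable_const measurable_const
  have hint : ∀ n, IntegrableOn (fun x => (N n x : ℝ)) (Set.Icc 0 1) := by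
    intro n
    refine Measure.integrableOn_of_bounded (M := n) (by simp)
      (hmeas n).aestronglyMeasurable (Eventually.of_forall fun x => ?_)
    rw [Real.norm_of_nonneg (Nat.cast_nonneg _), hN]
    exact_mod_cast (Finset.card_filter_le _ _).trans (Finset.card_range n).le
  refine ⟨(24 + 2 * C₁) * C₂ + 2 * C₁, by positivity, 4, fun n hn => ?_⟩
  have hn' : (4 : ℝ) ≤ n := by exact_mod_cast hn
  set L := Real.logb 2 (n : ℝ) with hL
  have hL0 : 0 ≤ L := Real.logb_nonneg one_lt_two (by linarith)
  have hpoint : ∀ x, ((Z (pref (ω x) n)).length : ℝ) ≤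
      (24 + 2 * C₁) * L * N n x + 2 * C₁ * L := by
    intro x
    set s := pref (ω x) n with hs
    have hlen : s.length = n := length_pref _ _
    have hk : s.count true = N n x := by rw [hN]; exact count_true_pref _ _
    have hs2 : 2 ≤ s.length := by omega
    have hH := length_mul_H1_le s hs2
    obtain ⟨ht1, ht2⟩ := ht s hs2
    have hZs := hZ s hs2
    have hsum : (s.count false : ℝ) + s.count true = s.length := by
      exact_mod_cast List.count_false_add_count_true s
    have hmax : (s.count false : ℝ) ≤ (max (s.count false) (s.count true) : ℕ) := by
      exact_mod_cast le_max_left _ _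
    rw [hlen] at hZs hH ht2 hsum
    rw [hk] at hH hsum
    have ht1' : (1 : ℝ) ≤ t s := by exact_mod_cast ht1
    have hll := logb_logb_max_le hn' ht1'
    have ht3 : (t s : ℝ) ≤ 2 * (N n x + 1) := by linarith
    have h3 : C₁ * (t s : ℝ) * Real.logb 2 (Real.logb 2 (max ((n : ℝ) / (t s : ℝ)) 4)) ≤
        C₁ * (2 * (N n x + 1)) * L := by
      calc _ ≤ C₁ * (t s : ℝ) * L := by gcongr
        _ ≤ _ := by gcongr
    nlinarith
  have hp0 : 0 ≤ p := by rw [hp]; exact one_div_nonneg.2 (by linarith)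
  have hnp : 1 ≤ (n : ℝ) ^ p := Real.one_le_rpow (by linarith) hp0
  calc ∫ x in Set.Icc (0 : ℝ) 1, ((Z (pref (ω x) n)).length : ℝ)
      ≤ ∫ x in Set.Icc (0 : ℝ) 1, ((24 + 2 * C₁) * L * N n x + 2 * C₁ * L) :=
        integral_mono_of_nonneg (Eventually.of_forall fun x => Nat.cast_nonneg _)
          (((hint n).const_mul _).add (integrable_const _)) (Eventually.of_forall hpoint)
    _ = (24 + 2 * C₁) * L * (∫ x in Set.Icc (0 : ℝ) 1, (N n x : ℝ)) + 2 * C₁ * L := by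
        rw [integral_add ((hint n).const_mul _) (integrable_const _), integral_const_mul]
        simp
    _ ≤ (24 + 2 * C₁) * L * (C₂ * (n : ℝ) ^ p) + 2 * C₁ * L * (n : ℝ) ^ p := by
        refine add_le_add ?_ (le_mul_of_one_le_right (by positivity) hnp)
        gcongr
        exact hNint n (by omega)
    _ = ((24 + 2 * C₁) * C₂ + 2 * C₁) * (n : ℝ) ^ p * L := by ring
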